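/- Let G be a group with a finite symmetric generating set S, and suppose G is finitely presented with respect to S: the kernel N of the canonical surjection FreeGroup S → G is the normal closure of a finite set R of reduced relator words. Let r be a natural number with 2r > |w| for every relator w ∈ R. Let Ω ⊆ G be a nonempty simply connected subset, i.e. both Ω and its complement Ω^c induce connected subgraphs of Cay(G,S), and suppose Ω^c is nonempty. Let Ω^{+r} = {g ∈ G : d(g,Ω) ≤ r} be the r-neighborhood of Ω. Then the set Ω^{+r} \ Ω induces a connected subgraph of Cay(G,S). -/

import Mathlib

/-- The Cayley graph of a group `G` with respect to a set `S`: `g` and `h` are adjacent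
iff `g⁻¹ * h ∈ S` (for symmetric `S` with `1 ∉ S`, `fromRel` gives exactly this relation). -/
def cayleyGraph {G : Type*} [Group G] (S : Set G) : SimpleGraph G :=
  SimpleGraph.fromRel (fun g h => g⁻¹ * h ∈ S)

/-- The `r`-neighborhood of a set `Ω` in the word metric: all points at graph distance
at most `r` from `Ω`. -/
def rNeighborhood {G : Type*} [Group G] (S : Set G) (Ω : Set G) (r : ℕ) : Set G :=
  {g : G | ∃ x ∈ Ω, (cayleyGraph S).dist g x ≤ r}

theorem cayleyGraph_adj_iff {G : Type*} [Group G] {S : Set G}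
    (hSsym : ∀ s ∈ S, s⁻¹ ∈ S) (hS1 : (1 : G) ∉ S) {g h : G} :
    (cayleyGraph S).Adj g h ↔ g⁻¹ * h ∈ S := by
  have key : ∀ a b : G, b⁻¹ * a ∈ S → a⁻¹ * b ∈ S := fun a b hab => by
    simpa using hSsym _ hab
  simp only [cayleyGraph, SimpleGraph.fromRel_adj]
  refine ⟨fun ⟨_, hgh⟩ => hgh.elim id (key g h), fun hgh => ⟨?_, Or.inl hgh⟩⟩
  rintro rfl
  exact hS1 (by simpa using hgh)

/-- The sum of an edge function along a walk. -/
def SimpleGraph.Walk.dartSum {V A : Type*} [AddCommGroup A] {H : SimpleGraph V}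
    (m : V → V → A) {u v : V} (p : H.Walk u v) : A :=
  (p.darts.map fun d => m d.fst d.snd).sum

/-- Translation by `s⁻¹` on `G`, lifted to the trivial bundle `G × A` by means of an
antisymmetric edge function `m`. -/
def cocyclePerm {G A : Type*} [Group G] [AddCommGroup A] (m : G → G → A)
    (hm : ∀ g h, m g h = -m h g) (s : G) : Equiv.Perm (G × A) where
  toFun x := (x.1 * s⁻¹, x.2 + m x.1 (x.1 * s⁻¹))
  invFun x := (x.1 * s, x.2 + m x.1 (x.1 * s))
  left_inv x := by
    ext
    · simp
    · simp [hm (x.1 * s⁻¹) x.1]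
  right_inv x := by
    ext
    · simp
    · simp [hm (x.1 * s) x.1]

theorem exists_walk_lift_cocyclePerm {G A : Type*} [Group G] [AddCommGroup A] {S : Set G}
    (hSsym : ∀ s ∈ S, s⁻¹ ∈ S) (hS1 : (1 : G) ∉ S) (m : G → G → A)
    (hm : ∀ g h, m g h = -m h g) (L : List (S × Bool)) (g : G) :
    ∃ (h : G) (p : (cayleyGraph S).Walk g h),
      h = g * (FreeGroup.lift (Subtype.val : S → G) (FreeGroup.mk L))⁻¹ ∧
      p.length = L.length ∧
      ∀ a : A, FreeGroup.lift (fun s : S => cocyclePerm m hm s) (FreeGroup.mk L) (g, a) =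
        (h, a + p.dartSum m) := by
  induction L with
  | nil => exact ⟨g, .nil, by simp, rfl, fun a => by simp [SimpleGraph.Walk.dartSum]⟩
  | cons x L ih =>
    obtain ⟨h, p, hh, hp, hφ⟩ := ih
    obtain ⟨s, b⟩ := x
    have hmk : FreeGroup.mk ((s, b) :: L) = FreeGroup.mk [(s, b)] * FreeGroup.mk L := by
      simp
    rw [hmk]
    cases b with
    | true =>
      have hadj : (cayleyGraph S).Adj h (h * (s : G)⁻¹) := by
        rw [cayleyGraph_adj_iff hSsym hS1]
        simpa using hSsym _ s.2
      refine ⟨h * (s : G)⁻¹, p.concat hadj, ?_, by simp [hp], fun a => ?_⟩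
      · rw [hh, map_mul]
        simp [mul_assoc]
      · rw [map_mul, Equiv.Perm.mul_apply, hφ]
        simp [cocyclePerm, SimpleGraph.Walk.dartSum, add_assoc]
    | false =>
      have hadj : (cayleyGraph S).Adj h (h * (s : G)) := by
        rw [cayleyGraph_adj_iff hSsym hS1]
        simp
      refine ⟨h * (s : G), p.concat hadj, ?_, by simp [hp], fun a => ?_⟩
      · rw [hh, map_mul]
        simp [mul_assoc]
      · rw [map_mul, Equiv.Perm.mul_apply, hφ]
        simp [cocyclePerm, SimpleGraph.Walk.dartSum, add_assoc, Equiv.symm]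

/-- An antisymmetric edge function on a Cayley graph whose sum along every closed walk of
length less than `n` vanishes is a coboundary, provided the group is presented by relators
of length less than `n`. -/
theorem exists_potential_of_dartSum_eq_zero {G A : Type*} [Group G] [DecidableEq G]
    [AddCommGroup A] {S : Set G} (hSsym : ∀ s ∈ S, s⁻¹ ∈ S) (hS1 : (1 : G) ∉ S)
    (hgen : Subgroup.closure S = ⊤) {R : Set (FreeGroup S)}
    (hpres : ((FreeGroup.lift (Subtype.val : S → G)).ker : Subgroup (FreeGroup S)) =
      Subgroup.normalClosure R)
    {n : ℕ} (hn : ∀ w ∈ R, (FreeGroup.toWord w).length < n) (m : G → G → A)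
    (hm : ∀ g h, m g h = -m h g)
    (hloop : ∀ (g : G) (p : (cayleyGraph S).Walk g g), p.length < n → p.dartSum m = 0) :
    ∃ f : G → A, ∀ g h, (cayleyGraph S).Adj g h → f h = f g + m g h := by
  set π := FreeGroup.lift (Subtype.val : S → G)
  set φ := FreeGroup.lift (fun s : S => cocyclePerm m hm s)
  have hker : π.ker ≤ φ.ker := by
    rw [hpres]
    refine Subgroup.normalClosure_le_normal fun w hw => ?_
    have hw1 : π w = 1 := by
      rw [← MonoidHom.mem_ker, hpres]
      exact Subgroup.subset_normalClosure hw
    change φ w = 1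
    ext1 ⟨g, a⟩
    obtain ⟨h, p, hh, hp, hφ⟩ :=
      exists_walk_lift_cocyclePerm hSsym hS1 m hm (FreeGroup.toWord w) g
    rw [FreeGroup.mk_toWord] at hh hφ
    change h = g * (π w)⁻¹ at hh
    obtain rfl : h = g := by simpa [hw1] using hh
    change ∀ a : A, φ w (_, a) = _ at hφ
    simp [hφ, hloop _ p (hp ▸ hn w hw)]
  have hfst : ∀ (w : FreeGroup S) (g : G) (a : A), (φ w (g, a)).1 = g * (π w)⁻¹ := by
    intro w g a
    obtain ⟨h, p, hh, -, hφ⟩ :=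
      exists_walk_lift_cocyclePerm hSsym hS1 m hm (FreeGroup.toWord w) g
    rw [FreeGroup.mk_toWord] at hh hφ
    change ∀ a : A, φ w (_, a) = _ at hφ
    rw [hφ]
    exact hh
  have hsurj : ∀ g : G, ∃ u, π u = g⁻¹ := by
    intro g
    have hrange : π.range = ⊤ := by
      rw [← hgen]
      simpa using FreeGroup.range_lift_eq_closure (f := (Subtype.val : S → G))
    exact MonoidHom.range_eq_top.1 hrange g⁻¹
  choose u hu using hsurj
  refine ⟨fun g => (φ (u g) (1, 0)).2, fun g h hgh => ?_⟩
  rw [cayleyGraph_adj_iff hSsym hS1] at hgh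
  have hs : h⁻¹ * g ∈ S := by simpa using hSsym _ hgh
  have heq : φ (u h) = φ (FreeGroup.of ⟨_, hs⟩ * u g) := by
    rw [← inv_mul_eq_one, ← map_inv, ← map_mul]
    apply hker
    simp [MonoidHom.mem_ker, hu, π]
  have hg : φ (u g) (1, 0) = (g, (φ (u g) (1, 0)).2) := by
    ext
    · simp [hfst, hu]
    · rfl
  simp only [heq, map_mul, Equiv.Perm.mul_apply]
  rw [hg]
  simp [φ, cocyclePerm]

theorem SimpleGraph.Walk.two_mul_dist_le_length {V : Type*} {H : SimpleGraph V}
    {g u v : V} (p : H.Walk g g) (hu : u ∈ p.support) (hv : v ∈ p.support) :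
    2 * H.dist v u ≤ p.length := by
  classical
  have hv' : v ∈ (p.rotate u hu).support := by simpa using hv
  have h1 := H.dist_le ((p.rotate u hu).takeUntil v hv')
  have h2 := H.dist_le ((p.rotate u hu).dropUntil v hv')
  have h3 := congrArg SimpleGraph.Walk.length ((p.rotate u hu).take_spec hv')
  rw [SimpleGraph.Walk.length_append] at h3
  rw [SimpleGraph.dist_comm] at h1
  have h4 : (p.rotate u hu).length = p.length := by simp
  omega

theorem SimpleGraph.Walk.dartSum_eq_sub {V A : Type*} [AddCommGroup A] {H : SimpleGraph V}
    (m : V → V → A) (f : V → A) (T : Set V)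
    (hf : ∀ u ∈ T, ∀ v ∈ T, H.Adj u v → m u v = f v - f u) {u v : V} (p : H.Walk u v)
    (hp : ∀ x ∈ p.support, x ∈ T) : p.dartSum m = f v - f u := by
  induction p with
  | nil => simp [dartSum]
  | cons h p ih =>
    have ih := ih fun x hx => hp x (by simp [hx])
    have := hf _ (hp _ (by simp)) _ (hp _ (by simp)) h
    simp only [dartSum, SimpleGraph.Walk.darts_cons, List.map_cons, List.sum_cons] at ih ⊢
    rw [ih, this]
    abel

/-- Following a short walk into `Ω` from a union of components of its collar reaches `Ω`
directly from that union. -/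
theorem SimpleGraph.Walk.exists_adj_of_isClosed {V : Type*} {H : SimpleGraph V}
    {Ω C : Set V} {r : ℕ}
    (hC : ∀ c ∈ C, ∀ d ∉ Ω, (∃ x ∈ Ω, H.dist d x ≤ r) → H.Adj c d → d ∈ C)
    (hCΩ : ∀ c ∈ C, c ∉ Ω) {u v : V} (p : H.Walk u v) (hu : u ∈ C) (hv : v ∈ Ω)
    (hp : p.length ≤ r) : ∃ c ∈ C, ∃ x ∈ Ω, H.Adj x c := by
  induction p with
  | nil => exact absurd hv (hCΩ _ hu)
  | @cons a b c h p ih =>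
    rw [SimpleGraph.Walk.length_cons] at hp
    by_cases hb : b ∈ Ω
    · exact ⟨a, hu, b, hb, h.symm⟩
    · exact ih (hC a hu b hb ⟨c, hv, (H.dist_le p).trans (by omega)⟩ h) hv (by omega)

theorem SimpleGraph.eq_of_induce_connected {V A : Type*} {H : SimpleGraph V} {T : Set V}
    (hT : (H.induce T).Connected) (f : V → A)
    (hf : ∀ u ∈ T, ∀ v ∈ T, H.Adj u v → f u = f v) {u v : V} (hu : u ∈ T) (hv : v ∈ T) :
    f u = f v := by
  obtain ⟨p⟩ := hT.preconnected ⟨u, hu⟩ ⟨v, hv⟩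
  have key : ∀ {x y : T}, (H.induce T).Walk x y → f x = f y := by
    intro x y p
    induction p with
    | nil => rfl
    | cons h p ih => exact (hf _ (Subtype.prop _) _ (Subtype.prop _) h).trans ih
  exact key p

theorem cayleyGraph_connected {G : Type*} [Group G] {S : Set G}
    (hSsym : ∀ s ∈ S, s⁻¹ ∈ S) (hS1 : (1 : G) ∉ S) (hgen : Subgroup.closure S = ⊤) :
    (cayleyGraph S).Connected := by
  have h1 : ∀ g : G, (cayleyGraph S).Reachable 1 g := by
    intro g
    have hg : g ∈ Subgroup.closure S := hgen ▸ Subgroup.mem_top g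
    induction hg using Subgroup.closure_induction_right with
    | one => exact .rfl
    | mul_right x hx y hy ih =>
      exact ih.trans ((cayleyGraph_adj_iff hSsym hS1).2 (by simpa using hy)).reachable
    | mul_inv_cancel x hx y hy ih =>
      exact ih.trans
        ((cayleyGraph_adj_iff hSsym hS1).2 (by simpa using hSsym _ hy)).reachable
  have : Nonempty G := ⟨1⟩
  exact ⟨fun g h => (h1 g).symm.trans (h1 h)⟩

/-- A nonempty symmetric set does not freely generate, as `s * s⁻¹` is then a relator. -/
theorem nonempty_relators_of_symmetric {G : Type*} [Group G] {S : Set G}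
    (hSsym : ∀ s ∈ S, s⁻¹ ∈ S) (hS : S.Nonempty) {R : Set (FreeGroup S)}
    (hpres : ((FreeGroup.lift (Subtype.val : S → G)).ker : Subgroup (FreeGroup S)) =
      Subgroup.normalClosure R) : R.Nonempty := by
  by_contra hR
  rw [Set.not_nonempty_iff_eq_empty] at hR
  obtain ⟨s, hs⟩ := hS
  have hmem : FreeGroup.of (⟨s, hs⟩ : S) * FreeGroup.of ⟨s⁻¹, hSsym s hs⟩ ∈
      Subgroup.normalClosure R := by
    rw [← hpres, MonoidHom.mem_ker]
    simp
  rw [hR, Subgroup.normalClosure_empty, Subgroup.mem_bot] at hmem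
  have h := congrArg (FreeGroup.lift fun _ : S => Multiplicative.ofAdd (1 : ℤ)) hmem
  rw [map_mul, FreeGroup.lift_apply_of, FreeGroup.lift_apply_of,
    (FreeGroup.lift fun _ : S => Multiplicative.ofAdd (1 : ℤ)).map_one] at h
  exact absurd h (by decide)


/-- Let `G` be finitely presented with respect to a finite symmetric generating set `S`,
with a finite set `R` of relators, and let `2 * r > |w|` for every `w ∈ R`. If
`Ω` is a nonempty simply connected subset (both `Ω` and its complement, also assumed
nonempty, induce connected subgraphs of the Cayley graph), then `Ω^{+r} \ Ω` induces a
connected subgraph of the Cayley graph. -/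
theorem thickened_boundary_connected_of_simplyConnected
    {G : Type*} [Group G] [DecidableEq G] (S : Set G)
    (hSfin : S.Finite) (hSsym : ∀ s ∈ S, s⁻¹ ∈ S) (hS1 : (1 : G) ∉ S)
    (hgen : Subgroup.closure S = ⊤)
    (R : Set (FreeGroup S)) (hRfin : R.Finite)
    (hpres : ((FreeGroup.lift (Subtype.val : S → G)).ker : Subgroup (FreeGroup S)) =
      Subgroup.normalClosure R)
    (r : ℕ) (hr : ∀ w ∈ R, (FreeGroup.toWord w).length < 2 * r)
    (Ω : Set G) (hΩne : Ω.Nonempty) (hΩcne : Ωᶜ.Nonempty)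
    (hΩconn : ((cayleyGraph S).induce Ω).Connected)
    (hΩcconn : ((cayleyGraph S).induce Ωᶜ).Connected) :
    ((cayleyGraph S).induce (rNeighborhood S Ω r \ Ω)).Connected := by
  classical
  have hconn := cayleyGraph_connected hSsym hS1 hgen
  set H := cayleyGraph S
  set B := rNeighborhood S Ω r \ Ω
  have hrpos : 1 ≤ r ∧ ∃ c ∉ Ω, ∃ x ∈ Ω, H.Adj x c := by
    obtain ⟨a, ha⟩ := hΩcne
    obtain ⟨x, hx⟩ := hΩne
    obtain ⟨p⟩ := hconn.preconnected a x
    obtain ⟨c, hc, y, hy, hyc⟩ := p.exists_adj_of_isClosed (C := Ωᶜ)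
      (fun _ _ d hd _ _ => hd) (fun _ hc => hc) ha hx le_rfl
    obtain ⟨w, hw⟩ := nonempty_relators_of_symmetric hSsym
      ⟨_, (cayleyGraph_adj_iff hSsym hS1).1 hyc⟩ hpres
    have := hr w hw
    exact ⟨by omega, c, hc, y, hy, hyc⟩
  obtain ⟨hr1, c₀, hc₀, x₀, hx₀, hadj₀⟩ := hrpos
  have hc₀B : c₀ ∈ B :=
    ⟨⟨x₀, hx₀, (SimpleGraph.dist_eq_one_iff_adj.2 hadj₀.symm).le.trans hr1⟩, hc₀⟩
  have hne : Nonempty B := ⟨⟨c₀, hc₀B⟩⟩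
  suffices hpre : (H.induce B).Preconnected from ⟨hpre⟩
  intro b₁ b₂
  by_contra hb
  let C : Set G := {g | ∃ h : g ∈ B, (H.induce B).Reachable b₁ ⟨g, h⟩}
  have hCB : ∀ c ∈ C, c ∈ B := fun c hc => hc.1
  have hCadj : ∀ c ∈ B, ∀ d ∈ B, H.Adj c d → c ∈ C → d ∈ C := by
    rintro c hc d hd hcd ⟨_, hreach⟩
    exact ⟨hd, hreach.trans (SimpleGraph.Adj.reachable (G := H.induce B) hcd)⟩
  have hexit : ∀ D ⊆ B, (∀ c ∈ B, ∀ d ∈ B, H.Adj c d → c ∈ D → d ∈ D) → D.Nonempty →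
      ∃ c ∈ D, ∃ x ∈ Ω, H.Adj x c := by
    rintro D hDB hD ⟨c, hc⟩
    obtain ⟨x, hx, hcx⟩ := (hDB hc).1
    obtain ⟨p, hp⟩ := hconn.exists_walk_length_eq_dist c x
    exact p.exists_adj_of_isClosed
      (fun c hc d hd hdx hcd => hD c (hDB hc) d ⟨hdx, hd⟩ hcd hc)
      (fun c hc => (hDB hc).2) hc hx (hp.trans_le hcx)
  obtain ⟨c, hc, x, hx, hxc⟩ := hexit C hCB hCadj ⟨b₁, b₁.2, .rfl⟩
  obtain ⟨d, ⟨hdB, hdC⟩, y, hy, hyd⟩ := hexit (B \ C) Set.sdiff_subset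
    (fun c hc d hd hcd hcC => ⟨hd, fun hdC => hcC.2 (hCadj d hd c hc hcd.symm hdC)⟩)
    ⟨b₂, b₂.2, fun h => hb h.2⟩
  let m : G → G → ZMod 2 := fun g h => if (g ∈ Ω ∧ h ∈ C) ∨ (h ∈ Ω ∧ g ∈ C) then 1 else 0
  have hmsymm : ∀ g h, m g h = -m h g := by
    intro g h
    rw [ZMod.neg_eq_self_mod_two]
    simp only [m, or_comm]
  have hmΩ : ∀ g ∈ Ω, ∀ h ∈ Ω, m g h = 0 := fun g hg h hh =>
    if_neg (by rintro (⟨-, h'⟩ | ⟨-, h'⟩) <;> exact (hCB _ h').2 ‹_›)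
  have hmΩc : ∀ g ∈ Ωᶜ, ∀ h ∈ Ωᶜ, m g h = 0 := fun g hg h hh =>
    if_neg (by rintro (⟨h', -⟩ | ⟨h', -⟩) <;> contradiction)
  have hloop : ∀ (g : G) (p : H.Walk g g), p.length < 2 * r → p.dartSum m = 0 := by
    intro g p hp
    by_cases hmeet : ∃ u ∈ p.support, u ∈ Ω
    · obtain ⟨u, hu, huΩ⟩ := hmeet
      rw [p.dartSum_eq_sub m (fun g => if g ∈ C then 1 else 0) (Ω ∪ B), sub_self]
      · intro g hg h hh hgh
        have h1 := hCadj g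
        have h2 := hCadj h
        have h3 := hCB g
        have h4 := hCB h
        have h5 : g ∈ B → g ∉ Ω := fun h => h.2
        have h6 : h ∈ B → h ∉ Ω := fun h => h.2
        have h7 := hgh.symm
        have h8 : (-1 : ZMod 2) = 1 := by decide
        simp only [m]
        by_cases hgC : g ∈ C <;> by_cases hhC : h ∈ C <;> grind
      · intro v hv
        by_cases hvΩ : v ∈ Ω
        · exact Or.inl hvΩ
        · have := p.two_mul_dist_le_length hu hv
          exact Or.inr ⟨⟨u, huΩ, show H.dist v u ≤ r by omega⟩, hvΩ⟩
    · rw [p.dartSum_eq_sub m (fun _ => 0) Ωᶜ, sub_self]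
      · intro g hg h hh _
        rw [hmΩc g hg h hh, sub_self]
      · exact fun v hv hvΩ => hmeet ⟨v, hv, hvΩ⟩
  obtain ⟨f, hf⟩ :=
    exists_potential_of_dartSum_eq_zero hSsym hS1 hgen hpres hr m hmsymm hloop
  have hfxy : f x = f y := SimpleGraph.eq_of_induce_connected hΩconn f
    (fun u hu v hv huv => by rw [hf u v huv, hmΩ u hu v hv, add_zero]) hx hy
  have hfcd : f c = f d := SimpleGraph.eq_of_induce_connected hΩcconn f
    (fun u hu v hv huv => by rw [hf u v huv, hmΩc u hu v hv, add_zero]) (hCB c hc).2 hdB.2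
  have hmxc : m x c = 1 := if_pos (Or.inl ⟨hx, hc⟩)
  have hmyd : m y d = 0 := if_neg (by
    rintro (⟨-, h'⟩ | ⟨h', -⟩)
    · exact hdC h'
    · exact hdB.2 h')
  rw [hf x c hxc, hf y d hyd, hmxc, hmyd, hfxy] at hfcd
  exact one_ne_zero (add_left_cancel hfcd)
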